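/- arXiv:1505.00049 — 2 statements merged into one kernel-verified Lean document; each statement's English description precedes it below -/
import Mathlib

section
/- Let ρ be a density operator in the spin-s representation and let μ₁ ≥ μ₂ ≥ μ₃ be the three eigenvalues of the covariance matrix Λ(ρ), listed in decreasing order. Then 4μ₁μ₂ ≥ s(s+1) − (μ₁ + μ₂ + μ₃). -/
open Matrix Complex
open scoped ComplexOrder

noncomputable section

/-- spin value s = j/2 -/
def sVal (j : ℕ) : ℝ := (j : ℝ) / 2

/-- m-value of the k-th basis vector: m = k - s -/
def mVal (j : ℕ) (k : Fin (j + 1)) : ℝ := (k : ℝ) - sVal j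

/-- L₃ -/
def L3 (j : ℕ) : Matrix (Fin (j + 1)) (Fin (j + 1)) ℂ :=
  Matrix.diagonal (fun k => (mVal j k : ℂ))

/-- raising operator L₊ -/
def Lp (j : ℕ) : Matrix (Fin (j + 1)) (Fin (j + 1)) ℂ :=
  Matrix.of fun i k =>
    if (i : ℕ) = (k : ℕ) + 1 then
      ((Real.sqrt (sVal j * (sVal j + 1) - mVal j k * (mVal j k + 1)) : ℝ) : ℂ)
    else 0

/-- lowering operator L₋ -/
def Lm (j : ℕ) : Matrix (Fin (j + 1)) (Fin (j + 1)) ℂ :=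
  Matrix.of fun i k =>
    if (i : ℕ) + 1 = (k : ℕ) then
      ((Real.sqrt (sVal j * (sVal j + 1) - mVal j k * (mVal j k - 1)) : ℝ) : ℂ)
    else 0

/-- L₁ = (L₊ + L₋)/2 -/
def L1 (j : ℕ) : Matrix (Fin (j + 1)) (Fin (j + 1)) ℂ := (1 / 2 : ℂ) • (Lp j + Lm j)

/-- L₂ = (L₊ − L₋)/(2i) -/
def L2 (j : ℕ) : Matrix (Fin (j + 1)) (Fin (j + 1)) ℂ :=
  (1 / (2 * Complex.I)) • (Lp j - Lm j)

/-- density operator -/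
def IsDensity {j : ℕ} (ρ : Matrix (Fin (j + 1)) (Fin (j + 1)) ℂ) : Prop :=
  ρ.PosSemidef ∧ ρ.trace = 1

/-- expectation value -/
def expVal {j : ℕ} (ρ A : Matrix (Fin (j + 1)) (Fin (j + 1)) ℂ) : ℝ :=
  ((ρ * A).trace).re

/-- variance -/
def Var {j : ℕ} (ρ A : Matrix (Fin (j + 1)) (Fin (j + 1)) ℂ) : ℝ :=
  ((ρ * A ^ 2).trace).re - (((ρ * A).trace).re) ^ 2

/-- angular momentum component along a direction e ∈ ℝ³ -/
def dirL (j : ℕ) (e : Fin 3 → ℝ) : Matrix (Fin (j + 1)) (Fin (j + 1)) ℂ :=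
  (e 0 : ℂ) • L1 j + (e 1 : ℂ) • L2 j + (e 2 : ℂ) • L3 j

/-- the three angular momentum components as a function `Fin 3 → Matrix` -/
def Lcomp (j : ℕ) : Fin 3 → Matrix (Fin (j + 1)) (Fin (j + 1)) ℂ := ![L1 j, L2 j, L3 j]

/-- the covariance matrix Λ(ρ) -/
def covMat {j : ℕ} (ρ : Matrix (Fin (j + 1)) (Fin (j + 1)) ℂ) : Matrix (Fin 3) (Fin 3) ℝ :=
  Matrix.of fun a b =>
    ((ρ * (Lcomp j a * Lcomp j b)).trace).re - expVal ρ (Lcomp j a) * expVal ρ (Lcomp j b)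

lemma conjTranspose_Lp (j : ℕ) : (Lp j)ᴴ = Lm j := by
  ext i k
  simp only [conjTranspose_apply, Lp, Lm, of_apply]
  by_cases h : (i : ℕ) + 1 = k
  · have hm : mVal j k - 1 = mVal j i := by
      simp only [mVal, ← h]
      push_cast
      ring
    have hm' : mVal j i + 1 = mVal j k := by linarith
    rw [if_pos h, if_pos h.symm, hm, hm']
    simp [mul_comm]
  · rw [if_neg h, if_neg (Ne.symm h), star_zero]

lemma conjTranspose_Lm (j : ℕ) : (Lm j)ᴴ = Lp j := by
  rw [← conjTranspose_Lp, conjTranspose_conjTranspose]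

lemma ladder_radicand (j : ℕ) (k : Fin (j + 1)) :
    sVal j * (sVal j + 1) - mVal j k * (mVal j k + 1) = ((j : ℝ) - k) * (k + 1) := by
  simp only [mVal, sVal]
  ring

lemma ladder_radicand_nonneg (j : ℕ) (k : Fin (j + 1)) :
    0 ≤ sVal j * (sVal j + 1) - mVal j k * (mVal j k + 1) := by
  rw [ladder_radicand]
  have : ((k : ℕ) : ℝ) ≤ j := by exact_mod_cast Nat.lt_succ_iff.mp k.isLt
  exact mul_nonneg (by linarith) (by positivity)

lemma Lm_mul_Lp (j : ℕ) :
    Lm j * Lp j = diagonal fun k =>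
      ((sVal j * (sVal j + 1) - mVal j k * (mVal j k + 1) : ℝ) : ℂ) := by
  rw [← conjTranspose_Lp]
  ext i k
  rw [mul_apply, diagonal_apply]
  simp only [conjTranspose_apply, Lp, of_apply]
  by_cases hk : (k : ℕ) < j
  · rw [Finset.sum_eq_single (⟨k + 1, by omega⟩ : Fin (j + 1))]
    · by_cases hik : i = k
      · subst hik
        simp only [if_true, RCLike.star_def, conj_ofReal]
        rw [← ofReal_mul, Real.mul_self_sqrt (ladder_radicand_nonneg j i)]
      · have h : (k : ℕ) + 1 ≠ (i : ℕ) + 1 := fun h => hik (Fin.ext (by omega))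
        simp [hik, Ne.symm (show (i : ℕ) ≠ k from fun h => hik (Fin.ext h))]
    · intro b _ hb
      have : (b : ℕ) ≠ k + 1 := fun h => hb (Fin.ext h)
      simp [this]
    · simp
  · have hkj : (k : ℕ) = j := by omega
    rw [Finset.sum_eq_zero]
    · split_ifs with hik
      · subst hik
        rw [ladder_radicand, hkj]
        simp
      · rfl
    · intro b _
      have : (b : ℕ) ≠ k + 1 := by omega
      simp [this]

lemma Lp_mul_Lm (j : ℕ) :
    Lp j * Lm j = diagonal fun k =>
      ((sVal j * (sVal j + 1) - mVal j k * (mVal j k - 1) : ℝ) : ℂ) := by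
  rw [← conjTranspose_Lp]
  ext i k
  rw [mul_apply, diagonal_apply]
  simp only [conjTranspose_apply, Lp, of_apply]
  by_cases hi : 0 < (i : ℕ)
  · have hi1 : (i : ℕ) - 1 < j + 1 := by omega
    have hi2 : (i : ℕ) = (⟨i - 1, hi1⟩ : Fin (j + 1)) + 1 := by simp; omega
    rw [Finset.sum_eq_single (⟨i - 1, hi1⟩ : Fin (j + 1))]
    · by_cases hik : i = k
      · subst hik
        rw [if_pos hi2, if_pos rfl, RCLike.star_def, conj_ofReal, ← ofReal_mul,
          Real.mul_self_sqrt (ladder_radicand_nonneg j _)]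
        have : mVal j i - 1 = mVal j ⟨i - 1, hi1⟩ := by
          simp only [mVal]
          rw [Nat.cast_sub hi]
          push_cast
          ring
        rw [← this]
        congr 1
        ring
      · have h : (k : ℕ) ≠ i - 1 + 1 := fun h => hik (Fin.ext (by omega))
        simp [hik, h]
    · intro b _ hb
      have : (i : ℕ) ≠ b + 1 := fun h => hb (Fin.ext (by simp; omega))
      simp [this]
    · simp
  · have hi0 : (i : ℕ) = 0 := by omega
    rw [Finset.sum_eq_zero]
    · split_ifs with hik
      · subst hik
        simp only [mVal, hi0]
        push_cast
        ring
      · rfl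
    · intro b _
      have : (i : ℕ) ≠ b + 1 := by omega
      simp [this]

lemma L3_mul_Lp (j : ℕ) : L3 j * Lp j = Lp j * L3 j + Lp j := by
  ext i k
  simp only [L3, diagonal_mul, mul_diagonal, Matrix.add_apply, Lp, of_apply]
  split_ifs with h
  · have : mVal j i = mVal j k + 1 := by
      simp only [mVal, h]
      push_cast
      ring
    rw [this]
    push_cast
    ring
  · simp

lemma isHermitian_L3 (j : ℕ) : (L3 j).IsHermitian := by
  ext i k
  rw [conjTranspose_apply, L3, diagonal_apply, diagonal_apply]
  by_cases h : i = k
  · subst h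
    simp
  · simp [h, Ne.symm h]

lemma L3_mul_Lm (j : ℕ) : L3 j * Lm j = Lm j * L3 j - Lm j := by
  have h := congrArg conjTranspose (L3_mul_Lp j)
  simp only [conjTranspose_mul, conjTranspose_add, conjTranspose_Lp, (isHermitian_L3 j).eq] at h
  rw [h, add_sub_cancel_right]

lemma Lp_mul_Lm_sub (j : ℕ) : Lp j * Lm j - Lm j * Lp j = (2 : ℂ) • L3 j := by
  rw [Lp_mul_Lm, Lm_mul_Lp, L3, diagonal_sub, ← diagonal_smul]
  congr 1
  funext k
  simp only [Pi.smul_apply, smul_eq_mul]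
  push_cast
  ring

lemma L2_eq (j : ℕ) : L2 j = (-I / 2) • (Lp j - Lm j) := by
  have : (1 / (2 * I) : ℂ) = -I / 2 := by
    field_simp
    simp
  rw [L2, this]

lemma isHermitian_L1 (j : ℕ) : (L1 j).IsHermitian := by
  simp only [IsHermitian, L1, conjTranspose_smul, conjTranspose_add, conjTranspose_Lp,
    conjTranspose_Lm, add_comm]
  simp

lemma isHermitian_L2 (j : ℕ) : (L2 j).IsHermitian := by
  simp only [IsHermitian, L2_eq, conjTranspose_smul, conjTranspose_sub, conjTranspose_Lp,
    conjTranspose_Lm]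
  rw [← neg_sub (Lp j), smul_neg, ← neg_smul]
  congr 1
  simp [neg_div]

lemma L1_commutator_L2 (j : ℕ) : L1 j * L2 j - L2 j * L1 j = I • L3 j := by
  have h : L1 j * L2 j - L2 j * L1 j = (I / 2) • (Lp j * Lm j - Lm j * Lp j) := by
    rw [L1, L2_eq]
    simp only [smul_mul_assoc, mul_smul_comm, add_mul, mul_add, sub_mul, mul_sub]
    module
  rw [h, Lp_mul_Lm_sub, smul_smul]
  congr 1
  ring

lemma L2_commutator_L3 (j : ℕ) : L2 j * L3 j - L3 j * L2 j = I • L1 j := by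
  rw [L1, L2_eq]
  simp only [smul_mul_assoc, mul_smul_comm, sub_mul, mul_sub, L3_mul_Lp, L3_mul_Lm]
  module

lemma L3_commutator_L1 (j : ℕ) : L3 j * L1 j - L1 j * L3 j = I • L2 j := by
  have h : I * (-I / 2) = 1 / 2 := by
    linear_combination (-1 / 2 : ℂ) * I_mul_I
  rw [L2_eq, smul_smul, h, L1]
  simp only [smul_mul_assoc, mul_smul_comm, add_mul, mul_add, L3_mul_Lp, L3_mul_Lm]
  module

lemma casimir (j : ℕ) :
    L1 j * L1 j + L2 j * L2 j + L3 j * L3 j = ((sVal j * (sVal j + 1) : ℝ) : ℂ) • 1 := by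
  have h : L1 j * L1 j + L2 j * L2 j = (1 / 2 : ℂ) • (Lp j * Lm j + Lm j * Lp j) := by
    have hI : (-I / 2) * (-I / 2) = -(1 / 4) := by
      linear_combination (1 / 4 : ℂ) * I_mul_I
    rw [L1, L2_eq]
    simp only [smul_mul_smul_comm, hI, add_mul, mul_add, sub_mul, mul_sub]
    module
  rw [h, Lp_mul_Lm, Lm_mul_Lp, L3, diagonal_add, ← diagonal_smul, diagonal_mul_diagonal,
    diagonal_add, smul_one_eq_diagonal]
  congr 1
  funext k
  simp only [Pi.smul_apply, smul_eq_mul]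
  push_cast
  ring

lemma isHermitian_Lcomp (j : ℕ) (a : Fin 3) : (Lcomp j a).IsHermitian := by
  fin_cases a
  exacts [isHermitian_L1 j, isHermitian_L2 j, isHermitian_L3 j]

/-- The Hermitian covariance matrix, whose real part is `covMat ρ`. -/
def complexCovMat {j : ℕ} (ρ : Matrix (Fin (j + 1)) (Fin (j + 1)) ℂ) :
    Matrix (Fin 3) (Fin 3) ℂ :=
  of fun a b =>
    (ρ * (Lcomp j a * Lcomp j b)).trace - (expVal ρ (Lcomp j a) * expVal ρ (Lcomp j b) : ℝ)

lemma star_trace_mul {n : Type*} [Fintype n] {ρ : Matrix n n ℂ} (hρ : ρ.IsHermitian)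
    (A : Matrix n n ℂ) : star (ρ * A).trace = (ρ * Aᴴ).trace := by
  rw [← trace_conjTranspose, conjTranspose_mul, hρ.eq, trace_mul_comm]

lemma trace_mul_eq_expVal {j : ℕ} {ρ A : Matrix (Fin (j + 1)) (Fin (j + 1)) ℂ}
    (hρ : ρ.IsHermitian) (hA : A.IsHermitian) : (ρ * A).trace = expVal ρ A := by
  have h := star_trace_mul hρ A
  rw [hA.eq] at h
  exact (conj_eq_iff_re.mp h).symm

lemma two_mul_im_trace_mul {j : ℕ} {ρ A B C : Matrix (Fin (j + 1)) (Fin (j + 1)) ℂ}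
    (hρ : ρ.IsHermitian) (hA : A.IsHermitian) (hB : B.IsHermitian)
    (hC : A * B - B * A = I • C) : 2 * (ρ * (A * B)).trace.im = expVal ρ C := by
  have h := star_trace_mul hρ (A * B)
  rw [conjTranspose_mul, hA.eq, hB.eq] at h
  have h2 : (ρ * (A * B)).trace - (ρ * (B * A)).trace = I * (ρ * C).trace := by
    rw [← trace_sub, ← mul_sub, hC, mul_smul_comm, trace_smul, smul_eq_mul]
  rw [← h] at h2
  have h3 := congrArg Complex.im h2
  simp at h3
  rw [expVal]
  linarith

lemma complexCovMat_isHermitian {j : ℕ} {ρ : Matrix (Fin (j + 1)) (Fin (j + 1)) ℂ}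
    (hρ : ρ.IsHermitian) : (complexCovMat ρ).IsHermitian := by
  ext a b
  simp only [conjTranspose_apply, complexCovMat, of_apply, star_sub, star_trace_mul hρ,
    conjTranspose_mul, (isHermitian_Lcomp j _).eq]
  rw [RCLike.star_def, conj_ofReal, mul_comm (expVal ρ _)]

lemma im_complexCovMat_swap {j : ℕ} {ρ : Matrix (Fin (j + 1)) (Fin (j + 1)) ℂ}
    (hρ : ρ.IsHermitian) (a b : Fin 3) :
    (complexCovMat ρ b a).im = -(complexCovMat ρ a b).im := by
  rw [← (complexCovMat_isHermitian hρ).apply b a]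
  simp

lemma complexCovMat_posSemidef {j : ℕ} {ρ : Matrix (Fin (j + 1)) (Fin (j + 1)) ℂ}
    (hρ : IsDensity ρ) : (complexCovMat ρ).PosSemidef := by
  have hH := hρ.1.isHermitian
  refine .of_dotProduct_mulVec_nonneg (complexCovMat_isHermitian hH) fun x => ?_
  let D : Fin 3 → Matrix (Fin (j + 1)) (Fin (j + 1)) ℂ :=
    fun a => Lcomp j a - (expVal ρ (Lcomp j a) : ℂ) • 1
  have hD (a : Fin 3) : (D a)ᴴ = D a := by
    simp [D, conjTranspose_sub, conjTranspose_smul, (isHermitian_Lcomp j a).eq]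
  have hcov (a b : Fin 3) : complexCovMat ρ a b = (ρ * (D a * D b)).trace := by
    simp only [D, sub_mul, mul_sub, smul_mul_assoc, mul_smul_comm, one_mul, mul_one, trace_sub,
      trace_smul, smul_eq_mul, trace_mul_eq_expVal hH (isHermitian_Lcomp j _), hρ.2,
      complexCovMat, of_apply]
    push_cast
    ring
  let B := ∑ a, x a • D a
  have hB : star x ⬝ᵥ complexCovMat ρ *ᵥ x = (B * ρ * Bᴴ).trace := by
    rw [trace_mul_comm, ← mul_assoc, trace_mul_comm]
    simp only [B, conjTranspose_sum, conjTranspose_smul, hD, Finset.sum_mul, Finset.mul_sum,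
      smul_mul_assoc, mul_smul_comm, trace_sum, trace_smul, smul_eq_mul, dotProduct, mulVec,
      Pi.star_apply, hcov]
    rw [Finset.sum_comm]
    exact Finset.sum_congr rfl fun a _ => Finset.sum_congr rfl fun b _ => by ring
  rw [hB]
  exact (hρ.1.mul_mul_conjTranspose_same B).trace_nonneg

lemma covMat_eq_map_re {j : ℕ} (ρ : Matrix (Fin (j + 1)) (Fin (j + 1)) ℂ) :
    covMat ρ = (complexCovMat ρ).map re := by
  ext a b
  simp [covMat, complexCovMat]

lemma trace_covMat {j : ℕ} {ρ : Matrix (Fin (j + 1)) (Fin (j + 1)) ℂ} (hρ : IsDensity ρ) :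
    (covMat ρ).trace =
      sVal j * (sVal j + 1) - (expVal ρ (L1 j) ^ 2 + expVal ρ (L2 j) ^ 2 + expVal ρ (L3 j) ^ 2) := by
  have h : (ρ * (L1 j * L1 j)).trace + (ρ * (L2 j * L2 j)).trace + (ρ * (L3 j * L3 j)).trace
      = ((sVal j * (sVal j + 1) : ℝ) : ℂ) := by
    rw [← trace_add, ← trace_add, ← mul_add, ← mul_add, casimir, mul_smul_comm, mul_one,
      trace_smul, hρ.2, smul_eq_mul, mul_one]
  have h' := congrArg Complex.re h
  simp only [add_re, ofReal_re] at h'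
  simp [trace_fin_three, covMat, Lcomp]
  linarith

lemma trace_im_complexCovMat {j : ℕ} {ρ : Matrix (Fin (j + 1)) (Fin (j + 1)) ℂ}
    (hρ : ρ.IsHermitian) :
    2 * ((complexCovMat ρ).map im * ((complexCovMat ρ).map im)ᵀ).trace =
      expVal ρ (L1 j) ^ 2 + expVal ρ (L2 j) ^ 2 + expVal ρ (L3 j) ^ 2 := by
  have hanti := im_complexCovMat_swap hρ
  have h00 := hanti 0 0
  have h11 := hanti 1 1
  have h22 := hanti 2 2
  have h01 : 2 * (complexCovMat ρ 0 1).im = expVal ρ (L3 j) := by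
    rw [← two_mul_im_trace_mul hρ (isHermitian_L1 j) (isHermitian_L2 j) (L1_commutator_L2 j)]
    simp [complexCovMat, Lcomp]
  have h12 : 2 * (complexCovMat ρ 1 2).im = expVal ρ (L1 j) := by
    rw [← two_mul_im_trace_mul hρ (isHermitian_L2 j) (isHermitian_L3 j) (L2_commutator_L3 j)]
    simp [complexCovMat, Lcomp]
  have h20 : 2 * (complexCovMat ρ 2 0).im = expVal ρ (L2 j) := by
    rw [← two_mul_im_trace_mul hρ (isHermitian_L3 j) (isHermitian_L1 j) (L3_commutator_L1 j)]
    simp [complexCovMat, Lcomp]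
  have z0 : (complexCovMat ρ 0 0).im = 0 := by linarith
  have z1 : (complexCovMat ρ 1 1).im = 0 := by linarith
  have z2 : (complexCovMat ρ 2 2).im = 0 := by linarith
  rw [← h01, ← h12, ← h20]
  simp only [trace_fin_three, mul_apply, Fin.sum_univ_three, transpose_apply, map_apply,
    z0, z1, z2, hanti 0 1, hanti 1 2, hanti 2 0]
  ring

/-- A positive semidefinite matrix `diag μ + i K` with `μ` decreasing and `K` real antisymmetric
satisfies `‖K‖² ≤ 2 μ₀ μ₁` in the Frobenius norm. -/
lemma trace_mul_transpose_le_of_posSemidef {μ : Fin 3 → ℝ} (h01 : μ 1 ≤ μ 0) (h12 : μ 2 ≤ μ 1)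
    {K : Matrix (Fin 3) (Fin 3) ℝ} (hK : Kᵀ = -K)
    (hM : ((diagonal μ).map ofReal + I • K.map ofReal : Matrix (Fin 3) (Fin 3) ℂ).PosSemidef) :
    (K * Kᵀ).trace ≤ 2 * μ 0 * μ 1 := by
  have hanti (a b : Fin 3) : K b a = -K a b := congrFun₂ hK a b
  have z (a : Fin 3) : K a a = 0 := by linarith [hanti a a]
  have hminor (a b : Fin 3) (hab : a ≠ b) : K a b ^ 2 ≤ μ a * μ b := by
    have h := (hM.submatrix ![a, b]).det_nonneg
    rw [det_fin_two] at h
    simp [hab, hab.symm, z, hanti a b] at h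
    have h' : (0 : ℂ) ≤ ((μ a * μ b - K a b ^ 2 : ℝ) : ℂ) := by
      convert h using 1
      push_cast
      linear_combination (-(K a b : ℂ) ^ 2) * I_mul_I
    linarith [zero_le_real.mp h']
  have hdet : 0 ≤ μ 0 * μ 1 * μ 2 - μ 2 * K 0 1 ^ 2 - μ 1 * K 0 2 ^ 2 - μ 0 * K 1 2 ^ 2 := by
    have h := hM.det_nonneg
    simp [det_fin_three, z, hanti 0 1, hanti 0 2, hanti 1 2] at h
    rw [← zero_le_real]
    convert h using 1
    push_cast
    linear_combination
      (-(μ 2 * K 0 1 ^ 2 + μ 1 * K 0 2 ^ 2 + μ 0 * K 1 2 ^ 2 : ℂ)) * I_mul_I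
  have h2 : 0 ≤ μ 2 := by
    simpa [z] using hM.diag_nonneg (i := 2)
  have htr : (K * Kᵀ).trace = 2 * (K 0 1 ^ 2 + K 0 2 ^ 2 + K 1 2 ^ 2) := by
    simp only [trace_fin_three, mul_apply, Fin.sum_univ_three, transpose_apply, z, hanti 0 1,
      hanti 0 2, hanti 1 2]
    ring
  rw [htr]
  suffices K 0 1 ^ 2 + K 0 2 ^ 2 + K 1 2 ^ 2 ≤ μ 0 * μ 1 by linarith
  rcases h2.eq_or_lt with h2 | h2
  · have m01 := hminor 0 1 (by decide)
    have m02 := hminor 0 2 (by decide)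
    have m12 := hminor 1 2 (by decide)
    rw [← h2, mul_zero] at m02 m12
    linarith
  · refine le_of_mul_le_mul_right ?_ h2
    nlinarith [mul_nonneg (sub_nonneg.mpr h12) (sq_nonneg (K 0 2)),
      mul_nonneg (sub_nonneg.mpr (h12.trans h01)) (sq_nonneg (K 1 2))]

/-- if μ₁ ≥ μ₂ ≥ μ₃ are the eigenvalues of the covariance matrix Λ(ρ),
    then 4μ₁μ₂ ≥ s(s+1) − (μ₁+μ₂+μ₃). -/
theorem covariance_eigenvalue_bound (j : ℕ) (hj : 0 < j)
    (ρ : Matrix (Fin (j + 1)) (Fin (j + 1)) ℂ) (hρ : IsDensity ρ)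
    (μ : Fin 3 → ℝ) (hord : μ 0 ≥ μ 1 ∧ μ 1 ≥ μ 2)
    (heig : ∃ O : Matrix (Fin 3) (Fin 3) ℝ,
      O.transpose * O = 1 ∧ covMat ρ = O * Matrix.diagonal μ * O.transpose) :
    4 * μ 0 * μ 1 ≥ sVal j * (sVal j + 1) - (μ 0 + μ 1 + μ 2) := by
  obtain ⟨O, hO, hcov⟩ := heig
  have hO' : O * Oᵀ = 1 := mul_eq_one_comm.mp hO
  have hH := hρ.1.isHermitian
  set H := complexCovMat ρ with hHdef
  set J := H.map im with hJ
  have hdec : H = (covMat ρ).map ofReal + I • J.map ofReal := by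
    ext a b
    rw [covMat_eq_map_re]
    simp [hJ, ← hHdef, mul_comm I, re_add_im]
  have hJanti : Jᵀ = -J := by
    ext a b
    exact im_complexCovMat_swap hH a b
  have hmap (A B : Matrix (Fin 3) (Fin 3) ℝ) :
      (A * B).map ofReal = (A.map ofReal * B.map ofReal : Matrix (Fin 3) (Fin 3) ℂ) :=
    Matrix.map_mul (f := ofRealHom)
  have hdiag : Oᵀ * covMat ρ * O = diagonal μ := by
    have h : Oᵀ * covMat ρ * O = (Oᵀ * O) * diagonal μ * (Oᵀ * O) := by
      rw [hcov]
      simp only [mul_assoc]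
    rw [h, hO, one_mul, mul_one]
  have hM : ((diagonal μ).map ofReal + I • (Oᵀ * J * O).map ofReal :
      Matrix (Fin 3) (Fin 3) ℂ).PosSemidef := by
    have h := (complexCovMat_posSemidef hρ).conjTranspose_mul_mul_same (O.map ofReal)
    have hconj : (O.map ofReal : Matrix (Fin 3) (Fin 3) ℂ)ᴴ = Oᵀ.map ofReal := by
      ext a b
      simp
    rw [← hHdef, hdec, hconj, mul_add, add_mul, mul_smul_comm, smul_mul_assoc, ← hmap, ← hmap,
      ← hmap, ← hmap, hdiag] at h
    exact h
  have hK : (Oᵀ * J * O)ᵀ = -(Oᵀ * J * O) := by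
    simp only [transpose_mul, transpose_transpose, hJanti, mul_assoc, neg_mul, mul_neg]
  have hbound := trace_mul_transpose_le_of_posSemidef hord.1 hord.2 hK hM
  have htrK : ((Oᵀ * J * O) * (Oᵀ * J * O)ᵀ).trace = (J * Jᵀ).trace := by
    have h : (Oᵀ * J * O) * (Oᵀ * J * O)ᵀ = Oᵀ * (J * (O * Oᵀ) * Jᵀ * O) := by
      simp only [transpose_mul, transpose_transpose, mul_assoc]
    rw [h, trace_mul_comm, hO', mul_one, mul_assoc, hO', mul_one]
  have hsum : (covMat ρ).trace = μ 0 + μ 1 + μ 2 := by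
    rw [hcov, trace_mul_comm, ← mul_assoc, hO, one_mul, trace_diagonal, Fin.sum_univ_three]
  have h1 := trace_covMat hρ
  have h2 := trace_im_complexCovMat hH
  rw [htrK] at hbound
  rw [← hHdef, ← hJ] at h2
  linarith
end
end

section
/- For spin s = 3/2 (dimension d = 4), every density operator ρ satisfies Var_ρ(L₁) + Var_ρ(L₃) ≥ 9/4 + γ² − √(4γ² + 2γ + 1), where γ = cos(π/9), and there exists a density operator attaining equality; i.e. the infimum of Var_ρ(L₁) + Var_ρ(L₃) over all density operators equals 9/4 + γ² − √(4γ² + 2γ + 1) ≈ 0.600933. -/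
open Matrix Complex
open scoped ComplexOrder

noncomputable section

lemma ofReal_sqrt_three_sq : ((√3 : ℝ) : ℂ) ^ 2 = 3 := by
  rw [← Complex.ofReal_pow, Real.sq_sqrt (by norm_num)]
  norm_num

lemma L3_three : L3 3 =
    !![(-3 / 2 : ℂ), 0, 0, 0; 0, -1 / 2, 0, 0; 0, 0, 1 / 2, 0; 0, 0, 0, 3 / 2] := by
  ext i k
  fin_cases i <;> fin_cases k <;> simp [L3, mVal, sVal] <;> norm_num

lemma sqrt_four : √(4 : ℝ) = 2 := by
  rw [show (4 : ℝ) = 2 ^ 2 by norm_num, Real.sqrt_sq (by norm_num)]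

lemma Lp_three : Lp 3 =
    !![(0 : ℂ), 0, 0, 0; (√3 : ℝ), 0, 0, 0; 0, 2, 0, 0; 0, 0, (√3 : ℝ), 0] := by
  ext i k
  fin_cases i <;> fin_cases k <;> simp [Lp, mVal, sVal] <;> norm_num [sqrt_four]

lemma Lm_three : Lm 3 =
    !![(0 : ℂ), (√3 : ℝ), 0, 0; 0, 0, 2, 0; 0, 0, 0, (√3 : ℝ); 0, 0, 0, 0] := by
  ext i k
  fin_cases i <;> fin_cases k <;> simp [Lm, mVal, sVal] <;> norm_num [sqrt_four]

lemma L1_three : L1 3 =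
    !![(0 : ℂ), (√3 : ℝ) / 2, 0, 0; (√3 : ℝ) / 2, 0, 1, 0;
      0, 1, 0, (√3 : ℝ) / 2; 0, 0, (√3 : ℝ) / 2, 0] := by
  rw [L1, Lp_three, Lm_three]
  ext i k
  fin_cases i <;> fin_cases k <;> simp <;> ring

lemma L2_three : L2 3 =
    !![(0 : ℂ), I * (√3 : ℝ) / 2, 0, 0; -I * (√3 : ℝ) / 2, 0, I, 0;
      0, -I, 0, I * (√3 : ℝ) / 2; 0, 0, -I * (√3 : ℝ) / 2, 0] := by
  rw [L2, Lp_three, Lm_three]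
  ext i k
  fin_cases i <;> fin_cases k <;> simp <;> ring

/-- `√8` times the rotation by a right angle about the first axis, in the spin-3/2
representation. -/
def quarterTurn : Matrix (Fin (3 + 1)) (Fin (3 + 1)) ℂ :=
  !![1, -I * (√3 : ℝ), -(√3 : ℝ), I; -I * (√3 : ℝ), -1, -I, -(√3 : ℝ);
    -(√3 : ℝ), -I, -1, -I * (√3 : ℝ); I, -(√3 : ℝ), -I * (√3 : ℝ), 1]

lemma quarterTurn_mul_conjTranspose :
    quarterTurn * quarterTurnᴴ = (8 : ℂ) • (1 : Matrix (Fin (3 + 1)) (Fin (3 + 1)) ℂ) := by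
  have h := ofReal_sqrt_three_sq
  ext i k
  fin_cases i <;> fin_cases k <;>
    simp [quarterTurn, Matrix.mul_apply, Fin.sum_univ_four] <;>
    grind [I_sq]

lemma L1_mul_quarterTurn : L1 3 * quarterTurn = quarterTurn * L1 3 := by
  have h := ofReal_sqrt_three_sq
  rw [L1_three]
  ext i k
  fin_cases i <;> fin_cases k <;>
    simp [quarterTurn, Matrix.mul_apply, Fin.sum_univ_four] <;> grind [I_sq]

lemma L3_mul_quarterTurn : L3 3 * quarterTurn = quarterTurn * L2 3 := by
  have h := ofReal_sqrt_three_sq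
  rw [L3_three, L2_three]
  ext i k
  fin_cases i <;> fin_cases k <;>
    simp [quarterTurn, Matrix.mul_apply, Fin.sum_univ_four] <;> grind [I_sq]

/-- The state `ρ` rotated by a right angle about the first axis. -/
def rotated (ρ : Matrix (Fin (3 + 1)) (Fin (3 + 1)) ℂ) : Matrix (Fin (3 + 1)) (Fin (3 + 1)) ℂ :=
  (1 / 8 : ℂ) • (quarterTurnᴴ * ρ * quarterTurn)

lemma trace_rotated_mul (ρ : Matrix (Fin (3 + 1)) (Fin (3 + 1)) ℂ)
    {A B : Matrix (Fin (3 + 1)) (Fin (3 + 1)) ℂ} (h : A * quarterTurn = quarterTurn * B) :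
    (rotated ρ * B).trace = (ρ * A).trace := by
  rw [rotated, Matrix.smul_mul, Matrix.trace_smul, Matrix.mul_assoc, ← h, Matrix.mul_assoc,
    Matrix.trace_mul_comm, Matrix.mul_assoc, Matrix.mul_assoc, quarterTurn_mul_conjTranspose,
    Matrix.mul_smul, Matrix.mul_smul, Matrix.trace_smul, Matrix.mul_one]
  simp

lemma IsDensity.rotated {ρ : Matrix (Fin (3 + 1)) (Fin (3 + 1)) ℂ} (h : IsDensity ρ) :
    IsDensity (rotated ρ) := by
  refine ⟨?_, ?_⟩
  · refine (h.1.conjTranspose_mul_mul_same quarterTurn).smul ?_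
    rw [show (1 / 8 : ℂ) = ((1 / 8 : ℝ) : ℂ) by norm_num]
    exact Complex.zero_le_real.mpr (by norm_num)
  · have := trace_rotated_mul ρ (A := 1) (B := 1) (by simp)
    rw [Matrix.mul_one, Matrix.mul_one] at this
    rw [this, h.2]

lemma Var_rotated (ρ : Matrix (Fin (3 + 1)) (Fin (3 + 1)) ℂ)
    {A B : Matrix (Fin (3 + 1)) (Fin (3 + 1)) ℂ} (h : A * quarterTurn = quarterTurn * B) :
    Var (rotated ρ) B = Var ρ A := by
  have h2 : A ^ 2 * quarterTurn = quarterTurn * B ^ 2 := by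
    rw [pow_two, pow_two, Matrix.mul_assoc, h, ← Matrix.mul_assoc, h, Matrix.mul_assoc]
  rw [Var, Var, trace_rotated_mul ρ h, trace_rotated_mul ρ h2]

lemma Matrix.PosSemidef.norm_apply_le {n : Type*} [Finite n] {M : Matrix n n ℂ}
    (h : M.PosSemidef) (i k : n) : ‖M i k‖ ≤ √(M i i).re * √(M k k).re := by
  have hi := Complex.nonneg_iff.mp (h.diag_nonneg (i := i))
  have hk := Complex.nonneg_iff.mp (h.diag_nonneg (i := k))
  have hd := (Complex.nonneg_iff.mp (h.submatrix ![i, k]).det_nonneg).1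
  have hki : M k i = star (M i k) := (h.1.apply k i).symm
  rw [← Real.sqrt_mul hi.1]
  refine Real.le_sqrt_of_sq_le ?_
  rw [Matrix.det_fin_two] at hd
  simp only [Matrix.submatrix_apply, Matrix.cons_val_zero, Matrix.cons_val_one, hki,
    Complex.sub_re, Complex.mul_re, ← hi.2, RCLike.star_def, Complex.conj_re,
    Complex.conj_im] at hd
  rw [Complex.sq_norm, Complex.normSq_apply]
  linarith

lemma Var_L1_add_Var_L2 {σ : Matrix (Fin (3 + 1)) (Fin (3 + 1)) ℂ} (h : σ.IsHermitian) :
    Var σ (L1 3) + Var σ (L2 3) =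
      3 / 2 * ((σ 0 0).re + (σ 3 3).re) + 7 / 2 * ((σ 1 1).re + (σ 2 2).re) -
        ‖(√3 : ℝ) * σ 0 1 + 2 * σ 1 2 + (√3 : ℝ) * σ 2 3‖ ^ 2 := by
  have hs : √3 ^ 2 = (3 : ℝ) := Real.sq_sqrt (by norm_num)
  have h10 : σ 1 0 = star (σ 0 1) := (h.apply 1 0).symm
  have h21 : σ 2 1 = star (σ 1 2) := (h.apply 2 1).symm
  have h32 : σ 3 2 = star (σ 2 3) := (h.apply 3 2).symm
  rw [Var, Var, L1_three, L2_three, Complex.sq_norm, Complex.normSq_apply]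
  simp [pow_two, Matrix.trace, Matrix.mul_apply, Fin.sum_univ_four, h10, h21, h32]
  grind

lemma spin_three_halves_form_nonneg {g r y₀ y₁ y₂ y₃ : ℝ} (hg : 8 * g ^ 3 - 6 * g = 1)
    (hg' : 3 / 4 ≤ g ^ 2) (hr : 0 ≤ r) :
    0 ≤ (r ^ 2 - 7 / 4 + 3 * g ^ 2) * (y₀ ^ 2 + y₃ ^ 2) +
        (r ^ 2 + 1 / 4 + 3 * g ^ 2) * (y₁ ^ 2 + y₂ ^ 2) -
        2 * r * (√3 * (y₀ * y₁) + 2 * (y₁ * y₂) + √3 * (y₂ * y₃)) := by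
  have hs : √3 ^ 2 = (3 : ℝ) := Real.sq_sqrt (by norm_num)
  set D := r ^ 2 - 7 / 4 + 3 * g ^ 2 with hD
  have hD0 : 0 < D := by nlinarith
  have key : 0 ≤ D * (D + 2 - 2 * r) - 3 * r ^ 2 := by
    have : D * (D + 2 - 2 * r) - 3 * r ^ 2 =
        (r - 1 / 2 - g) ^ 2 * ((r - 1 / 2 + g) ^ 2 + (8 * g ^ 2 - 6)) := by
      rw [hD]
      linear_combination (2 * r - 1) * hg
    rw [this]
    have : 0 ≤ 8 * g ^ 2 - 6 := by linarith
    positivity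
  refine nonneg_of_mul_nonneg_right ?_ hD0
  have : D * (D * (y₀ ^ 2 + y₃ ^ 2) + (r ^ 2 + 1 / 4 + 3 * g ^ 2) * (y₁ ^ 2 + y₂ ^ 2) -
      2 * r * (√3 * (y₀ * y₁) + 2 * (y₁ * y₂) + √3 * (y₂ * y₃))) =
      (D * y₀ - √3 * r * y₁) ^ 2 + (D * y₃ - √3 * r * y₂) ^ 2 +
      (D * (D + 2 - 2 * r) - 3 * r ^ 2) * (y₁ ^ 2 + y₂ ^ 2) +
      2 * r * D * (y₁ - y₂) ^ 2 := by
    rw [show r ^ 2 + 1 / 4 + 3 * g ^ 2 = D + 2 by rw [hD]; ring]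
    linear_combination (-(r ^ 2 * (y₁ ^ 2 + y₂ ^ 2))) * hs
  rw [this]
  positivity

lemma le_Var_L1_add_Var_L2 {g : ℝ} (hg : 8 * g ^ 3 - 6 * g = 1) (hg' : 3 / 4 ≤ g ^ 2)
    {σ : Matrix (Fin (3 + 1)) (Fin (3 + 1)) ℂ} (h : IsDensity σ) :
    13 / 4 - 3 * g ^ 2 ≤ Var σ (L1 3) + Var σ (L2 3) := by
  rw [Var_L1_add_Var_L2 h.1.1]
  set r := ‖(√3 : ℝ) * σ 0 1 + 2 * σ 1 2 + (√3 : ℝ) * σ 2 3‖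
  have hr : 0 ≤ r := norm_nonneg _
  have hle : r ≤ √3 * (√(σ 0 0).re * √(σ 1 1).re) + 2 * (√(σ 1 1).re * √(σ 2 2).re) +
      √3 * (√(σ 2 2).re * √(σ 3 3).re) := by
    refine norm_add₃_le.trans ?_
    simp only [norm_mul, Complex.norm_real, Complex.norm_ofNat, Real.norm_eq_abs,
      abs_of_nonneg (Real.sqrt_nonneg 3)]
    gcongr <;> exact h.1.norm_apply_le _ _
  have hsq (i) : √(σ i i).re ^ 2 = (σ i i).re :=
    Real.sq_sqrt (Complex.nonneg_iff.mp h.1.diag_nonneg).1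
  have htr : (σ 0 0).re + (σ 1 1).re + (σ 2 2).re + (σ 3 3).re = 1 := by
    simpa [Matrix.trace, Fin.sum_univ_four] using congrArg Complex.re h.2
  have key := spin_three_halves_form_nonneg (y₀ := √(σ 0 0).re) (y₁ := √(σ 1 1).re)
    (y₂ := √(σ 2 2).re) (y₃ := √(σ 3 3).re) hg hg' hr
  rw [hsq, hsq, hsq, hsq] at key
  linear_combination key + 2 * r * hle + (r ^ 2 + 3 * g ^ 2 - 13 / 4) * htr

/-- The pure state with amplitudes `q` and `p` on the basis vectors `|-1/2⟩` and `|3/2⟩`. -/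
def twoLevelState (p q : ℝ) : Matrix (Fin (3 + 1)) (Fin (3 + 1)) ℂ :=
  Matrix.vecMulVec ![0, (q : ℂ), 0, (p : ℂ)] (star ![0, (q : ℂ), 0, (p : ℂ)])

lemma twoLevelState_eq (p q : ℝ) : twoLevelState p q =
    !![0, 0, 0, 0; 0, (q : ℂ) * q, 0, (q : ℂ) * p; 0, 0, 0, 0; 0, (p : ℂ) * q, 0, (p : ℂ) * p] := by
  ext i k
  fin_cases i <;> fin_cases k <;> simp [twoLevelState, Matrix.vecMulVec_apply, -vecMulVec_cons]

lemma isDensity_twoLevelState {p q : ℝ} (h : p ^ 2 + q ^ 2 = 1) :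
    IsDensity (twoLevelState p q) := by
  refine ⟨Matrix.posSemidef_vecMulVec_self_star _, ?_⟩
  have h' : (p : ℂ) ^ 2 + (q : ℂ) ^ 2 = 1 := by exact_mod_cast h
  simp [twoLevelState_eq, Matrix.trace, Fin.sum_univ_four]
  linear_combination h'

lemma Var_twoLevelState (p q : ℝ) :
    Var (twoLevelState p q) (L1 3) + Var (twoLevelState p q) (L3 3) =
      3 * p ^ 2 + 2 * q ^ 2 + √3 * p * q - (3 / 2 * p ^ 2 - 1 / 2 * q ^ 2) ^ 2 := by
  have hs : √3 ^ 2 = (3 : ℝ) := Real.sq_sqrt (by norm_num)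
  rw [Var, Var, L1_three, L3_three, twoLevelState_eq]
  simp [pow_two, Matrix.trace, Fin.sum_univ_four]
  grind

lemma cos_pi_div_nine_cubic : 8 * Real.cos (Real.pi / 9) ^ 3 - 6 * Real.cos (Real.pi / 9) = 1 := by
  have h := Real.cos_three_mul (Real.pi / 9)
  rw [show 3 * (Real.pi / 9) = Real.pi / 3 by ring, Real.cos_pi_div_three] at h
  linarith

lemma cos_pi_div_nine_pos : 0 < Real.cos (Real.pi / 9) :=
  Real.cos_pos_of_mem_Ioo ⟨by linarith [Real.pi_pos], by linarith [Real.pi_pos]⟩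

lemma three_fourths_le_cos_pi_div_nine_sq : 3 / 4 ≤ Real.cos (Real.pi / 9) ^ 2 := by
  nlinarith [cos_pi_div_nine_cubic, cos_pi_div_nine_pos]

lemma sqrt_cos_pi_div_nine :
    √(4 * Real.cos (Real.pi / 9) ^ 2 + 2 * Real.cos (Real.pi / 9) + 1) =
      4 * Real.cos (Real.pi / 9) ^ 2 - 1 := by
  have h := cos_pi_div_nine_cubic
  have h' := three_fourths_le_cos_pi_div_nine_sq
  rw [Real.sqrt_eq_iff_eq_sq (by nlinarith [cos_pi_div_nine_pos]) (by linarith)]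
  linear_combination (-2 * Real.cos (Real.pi / 9)) * h

lemma Var_twoLevelState_pi_div_eighteen :
    Var (twoLevelState (Real.cos (Real.pi / 18)) (-Real.sin (Real.pi / 18))) (L1 3) +
      Var (twoLevelState (Real.cos (Real.pi / 18)) (-Real.sin (Real.pi / 18))) (L3 3) =
      13 / 4 - 3 * Real.cos (Real.pi / 9) ^ 2 := by
  have hcos := Real.cos_two_mul (Real.pi / 18)
  have hsin := Real.sin_two_mul (Real.pi / 18)
  have hcs := Real.cos_sq_add_sin_sq (Real.pi / 18)
  rw [show 2 * (Real.pi / 18) = Real.pi / 9 by ring] at hcos hsin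
  have hc2 := Real.cos_two_mul (Real.pi / 9)
  rw [show 2 * (Real.pi / 9) = Real.pi / 3 - Real.pi / 9 by ring, Real.cos_sub,
    Real.cos_pi_div_three, Real.sin_pi_div_three] at hc2
  have hp : Real.cos (Real.pi / 18) ^ 2 = (1 + Real.cos (Real.pi / 9)) / 2 := by linarith
  have hq : (-Real.sin (Real.pi / 18)) ^ 2 = (1 - Real.cos (Real.pi / 9)) / 2 := by
    rw [neg_sq]; linarith
  rw [Var_twoLevelState, hp, hq]
  linear_combination √3 / 2 * hsin - hc2

/-- for spin s = 3/2 the optimal lower bound on Var(L₁) + Var(L₃) is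
    9/4 + γ² − √(4γ² + 2γ + 1) with γ = cos(π/9). -/
theorem two_component_bound_spin_three_halves :
    let γ : ℝ := Real.cos (Real.pi / 9)
    (∀ ρ : Matrix (Fin (3 + 1)) (Fin (3 + 1)) ℂ, IsDensity ρ →
      9 / 4 + γ ^ 2 - Real.sqrt (4 * γ ^ 2 + 2 * γ + 1) ≤
        Var ρ (L1 3) + Var ρ (L3 3)) ∧
    (∃ ρ : Matrix (Fin (3 + 1)) (Fin (3 + 1)) ℂ, IsDensity ρ ∧
      Var ρ (L1 3) + Var ρ (L3 3) =
        9 / 4 + γ ^ 2 - Real.sqrt (4 * γ ^ 2 + 2 * γ + 1)) := by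
  intro γ
  have hmin : 9 / 4 + γ ^ 2 - √(4 * γ ^ 2 + 2 * γ + 1) = 13 / 4 - 3 * γ ^ 2 := by
    rw [sqrt_cos_pi_div_nine]
    ring
  rw [hmin]
  refine ⟨fun ρ hρ => ?_, twoLevelState (Real.cos (Real.pi / 18)) (-Real.sin (Real.pi / 18)),
    isDensity_twoLevelState (by rw [neg_sq]; exact Real.cos_sq_add_sin_sq _),
    Var_twoLevelState_pi_div_eighteen⟩
  rw [← Var_rotated ρ L1_mul_quarterTurn, ← Var_rotated ρ L3_mul_quarterTurn]
  exact le_Var_L1_add_Var_L2 cos_pi_div_nine_cubic three_fourths_le_cos_pi_div_nine_sq hρ.rotated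
end
end
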